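/- Equations of motion of the radiating electron from a second-order contact Lagrangian: Let n = 3, k = 2, let V : ℝ³ → ℝ be smooth, m > 0, τ ≠ 0, and L(q₀,q₁,q₂,z) = (mτ²/32)|q₂|² + V(q₀) + (4/τ)z. Then a smooth pair (q, z) : ℝ → ℝ³ × ℝ with z′(t) = L(q(t), q′(t), q″(t), z(t)) satisfies the 2k-th order Herglotz equations for L if and only if for all t and all i = 1,2,3: (mτ²/16) q⁗ⁱ(t) − (mτ/2) q‴ⁱ(t) + m q″ⁱ(t) = −(∂V/∂q₀^i)(q(t)). -/

import Mathlib

open scoped BigOperators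

noncomputable section

namespace HOC

/-- Infinite-jet coordinates `(q_α)_{α ∈ ℕ}` with each `q_α ∈ ℝⁿ`. -/
abbrev Jet (n : ℕ) := ℕ → Fin n → ℝ

/-- Partial derivative of a jet function with respect to the coordinate `q_α^i`. -/
def pq {n : ℕ} (F : Jet n → ℝ → ℝ) (α : ℕ) (i : Fin n) (q : Jet n) (z : ℝ) : ℝ :=
  deriv (fun s : ℝ => F (Function.update q α (Function.update (q α) i s)) z) (q α i)

/-- Partial derivative of a jet function with respect to `z`. -/
def pz {n : ℕ} (F : Jet n → ℝ → ℝ) (q : Jet n) (z : ℝ) : ℝ :=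
  deriv (fun w => F q w) z

/-- Extension of a function of `(q₀,…,q_k,z)` to the jet space, ignoring higher coordinates. -/
def ext {n : ℕ} (k : ℕ) (L : (Fin (k+1) → Fin n → ℝ) → ℝ → ℝ) : Jet n → ℝ → ℝ :=
  fun q z => L (fun α => q α.val) z

/-- The Lagrangian total derivative `D_L` acting on functions of `(q₀,…,q_r,z)`. -/
def DL {n : ℕ} (Lx : Jet n → ℝ → ℝ) (r : ℕ) (F : Jet n → ℝ → ℝ) : Jet n → ℝ → ℝ :=
  fun q z =>
    (∑ α ∈ Finset.range (r+1), ∑ i : Fin n, q (α+1) i * pq F α i q z)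
      + Lx q z * pz F q z - pz Lx q z * F q z

/-- Iterated Lagrangian total derivative `D_L^α`, applied to a function of order `r`. -/
def DLpow {n : ℕ} (Lx : Jet n → ℝ → ℝ) (r : ℕ) : ℕ → (Jet n → ℝ → ℝ) → (Jet n → ℝ → ℝ)
  | 0, F => F
  | (α+1), F => DL Lx (r + α) (DLpow Lx r α F)

/-- The infinite jet lift of a curve `c : ℝ → ℝⁿ`. -/
def lift {n : ℕ} (c : ℝ → Fin n → ℝ) (t : ℝ) : Jet n :=
  fun α => iteratedDeriv α c t

/-- The `k`-jet lift `c̄ᵏ(t) = (c(t), c'(t), …, c⁽ᵏ⁾(t))`. -/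
def jetk {n : ℕ} (k : ℕ) (c : ℝ → Fin n → ℝ) (t : ℝ) : Fin (k+1) → Fin n → ℝ :=
  fun α => iteratedDeriv α.val c t

/-- Smoothness of a Lagrangian of order `k`. -/
def SmoothL {n k : ℕ} (L : (Fin (k+1) → Fin n → ℝ) → ℝ → ℝ) : Prop :=
  ContDiff ℝ (⊤ : ℕ∞) (fun p : (Fin (k+1) → Fin n → ℝ) × ℝ => L p.1 p.2)

/-- The Jacobi–Ostrogradskii momentum `p̂^{r-1}_i = ∑_{α=0}^{k-r} (-1)^α D_L^α (∂L/∂q_{r+α}^i)`. -/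
def momentum {n : ℕ} (k : ℕ) (L : (Fin (k+1) → Fin n → ℝ) → ℝ → ℝ) (r : ℕ) (i : Fin n) :
    Jet n → ℝ → ℝ :=
  fun q z => ∑ α ∈ Finset.range (k - r + 1),
    (-1:ℝ)^α * DLpow (ext k L) k α (pq (ext k L) (r + α) i) q z

/-- The `2k`-th order Herglotz (contact Euler–Lagrange) equations for the pair `(c, z)`. -/
def HerglotzEqs {n : ℕ} (k : ℕ) (L : (Fin (k+1) → Fin n → ℝ) → ℝ → ℝ)
    (c : ℝ → Fin n → ℝ) (z : ℝ → ℝ) : Prop :=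
  ∀ (t : ℝ) (i : Fin n),
    ∑ α ∈ Finset.range (k+1),
      (-1:ℝ)^α * DLpow (ext k L) k α (pq (ext k L) α i) (lift c t) (z t) = 0

/-- The Herglotz ODE `z'(t) = L(c̄ᵏ(t), z(t))`. -/
def HerglotzODE {n : ℕ} (k : ℕ) (L : (Fin (k+1) → Fin n → ℝ) → ℝ → ℝ)
    (c : ℝ → Fin n → ℝ) (z : ℝ → ℝ) : Prop :=
  ∀ t : ℝ, HasDerivAt z (L (jetk k c t) (z t)) t

/-- The Lagrangian energy `E_L = ∑_{r=1}^{k} ∑_i p̂^{r-1}_i q_r^i - L`. -/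
def energy {n : ℕ} (k : ℕ) (L : (Fin (k+1) → Fin n → ℝ) → ℝ → ℝ) : Jet n → ℝ → ℝ :=
  fun q z =>
    (∑ r ∈ Finset.range k, ∑ i : Fin n, momentum k L (r+1) i q z * q (r+1) i) - ext k L q z

/-- Padding a finite collection of coordinates by zero to an infinite jet. -/
def padJet {n : ℕ} (m : ℕ) (q : Fin m → Fin n → ℝ) : Jet n :=
  fun α => if h : α < m then q ⟨α, h⟩ else 0

/-- The generalized Legendre map in coordinates:
`Leg (q₀,…,q_{2k-1}, z) = (q₀,…,q_{k-1}, p̂⁰,…,p̂^{k-1}, z)`. -/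
def Leg {n : ℕ} (k : ℕ) (L : (Fin (k+1) → Fin n → ℝ) → ℝ → ℝ) :
    ((Fin (2*k) → Fin n → ℝ) × ℝ) → ((Fin (2*k) → Fin n → ℝ) × ℝ) :=
  fun w =>
    (fun β i => if (β : ℕ) < k then w.1 β i
      else momentum k L ((β : ℕ) - k + 1) i (padJet (2*k) w.1) w.2, w.2)


theorem hasDerivAt_update_coord {n : ℕ} (q : Jet n) (α β : ℕ) (i j : Fin n) :
    HasDerivAt (fun s : ℝ => Function.update q α (Function.update (q α) i s) β j)
      (if α = β ∧ i = j then 1 else 0) (q α i) := by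
  by_cases hα : α = β
  · subst hα
    by_cases hi : i = j
    · subst hi
      simpa using hasDerivAt_id' (q α i)
    · simpa [hi, Function.update_of_ne (Ne.symm hi)] using hasDerivAt_const (q α i) (q α j)
  · simpa [hα, Function.update_of_ne (Ne.symm hα)] using hasDerivAt_const (q α i) (q β j)

theorem pq_linear {n : ℕ} (a b : ℝ) (β γ : ℕ) (j : Fin n) (α : ℕ) (i : Fin n) (q : Jet n)
    (z : ℝ) :
    pq (fun q _ => a * q β j + b * q γ j) α i q z =
      a * (if α = β ∧ i = j then 1 else 0) + b * (if α = γ ∧ i = j then 1 else 0) :=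
  (((hasDerivAt_update_coord q α β i j).const_mul a).add
    ((hasDerivAt_update_coord q α γ i j).const_mul b)).deriv

/-- On functions linear in the coordinates, `D_L` shifts coordinates up and subtracts
`(∂L/∂z) F`. -/
theorem DL_linear {n : ℕ} (Lx : Jet n → ℝ → ℝ) (r : ℕ) (a b : ℝ) {β γ : ℕ} (hβ : β ≤ r)
    (hγ : γ ≤ r) (j : Fin n) (q : Jet n) (z : ℝ) :
    DL Lx r (fun q _ => a * q β j + b * q γ j) q z =
      a * q (β + 1) j + b * q (γ + 1) j - pz Lx q z * (a * q β j + b * q γ j) := by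
  have hsum : ∀ (e : ℝ) (δ : ℕ), δ ≤ r →
      ∑ α ∈ Finset.range (r + 1), ∑ i : Fin n,
        q (α + 1) i * (e * (if α = δ ∧ i = j then 1 else 0)) = e * q (δ + 1) j := by
    intro e δ hδ
    rw [Finset.sum_eq_single_of_mem δ (Finset.mem_range.2 (by omega)) (by
      intro α _ hα; simp [hα])]
    simp [mul_comm]
  have hpz : pz (fun (q : Jet n) (_ : ℝ) => a * q β j + b * q γ j) q z = 0 := by simp [pz]
  simp only [DL, hpz, pq_linear, mul_add, Finset.sum_add_distrib, hsum a β hβ, hsum b γ hγ]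
  ring

theorem DL_zero {n : ℕ} (Lx : Jet n → ℝ → ℝ) (r : ℕ) (q : Jet n) (z : ℝ) :
    DL Lx r (fun _ _ => 0) q z = 0 := by
  simp [DL, pq, pz]

theorem iteratedDeriv_apply_coord {n : ℕ} {c : ℝ → Fin n → ℝ} (hc : ContDiff ℝ (⊤ : ℕ∞) c)
    (k : ℕ) (i : Fin n) (t : ℝ) :
    iteratedDeriv k (fun s => c s i) t = iteratedDeriv k c t i := by
  induction k generalizing t with
  | zero => simp
  | succ k ih =>
    rw [iteratedDeriv_succ, iteratedDeriv_succ, funext ih]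
    have hd : DifferentiableAt ℝ (iteratedDeriv k c) t :=
      (hc.differentiable_iteratedDeriv k (by exact_mod_cast ENat.natCast_lt_top k)).differentiableAt
    exact (hasDerivAt_pi.1 hd.hasDerivAt i).deriv

/-- Equations of motion of the radiating electron from a
second-order contact Lagrangian. -/
theorem radiating_electron
    (V : (Fin 3 → ℝ) → ℝ) (hV : ContDiff ℝ (⊤ : ℕ∞) V)
    (m τ : ℝ) (hm : 0 < m) (hτ : τ ≠ 0)
    (L : (Fin 3 → Fin 3 → ℝ) → ℝ → ℝ)
    (hLdef : ∀ (Q : Fin 3 → Fin 3 → ℝ) (w : ℝ),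
      L Q w = (m * τ^2 / 32) * (∑ i : Fin 3, (Q 2 i)^2) + V (Q 0) + (4 / τ) * w)
    (c : ℝ → Fin 3 → ℝ) (hc : ContDiff ℝ (⊤ : ℕ∞) c)
    (z : ℝ → ℝ) (hz : ContDiff ℝ (⊤ : ℕ∞) z)
    (hode : HerglotzODE 2 L c z) :
    HerglotzEqs 2 L c z ↔
    (∀ (t : ℝ) (i : Fin 3),
      (m * τ^2 / 16) * iteratedDeriv 4 (fun s => c s i) t
        - (m * τ / 2) * iteratedDeriv 3 (fun s => c s i) t
        + m * iteratedDeriv 2 (fun s => c s i) t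
        = -(deriv (fun s => V (Function.update (c t) i s)) (c t i))) := by
  have hext : ext 2 L = fun (q : Jet 3) w =>
      (m * τ^2 / 32) * (∑ i : Fin 3, (q 2 i)^2) + V (q 0) + (4 / τ) * w := by
    funext q w
    simp [ext, hLdef]
  have hpz : ∀ (q : Jet 3) (w : ℝ), pz (ext 2 L) q w = 4 / τ := by
    intro q w
    rw [hext]
    exact (((hasDerivAt_id w).const_mul (4 / τ)).const_add _).deriv.trans (mul_one _)
  have hpq0 : ∀ (i : Fin 3) (q : Jet 3) (w : ℝ), pq (ext 2 L) 0 i q w =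
      deriv (fun s => V (Function.update (q 0) i s)) (q 0 i) := by
    intro i q w
    simp [hext, pq]
  have hpq1 : ∀ i : Fin 3, pq (ext 2 L) 1 i = fun _ _ => 0 := by
    intro i
    funext q w
    simp [hext, pq]
  have hpq2 : ∀ i : Fin 3, pq (ext 2 L) 2 i =
      fun q _ => (m * τ^2 / 16) * q 2 i + 0 * q 2 i := by
    intro i
    funext q w
    have h := (((HasDerivAt.fun_sum fun j (_ : j ∈ Finset.univ) =>
      (hasDerivAt_update_coord q 2 2 i j).fun_pow 2).const_mul (m * τ^2 / 32)).add_const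
        (V (q 0))).add_const ((4 / τ) * w)
    have h' := h.deriv
    simp only [pq, hext]
    simp only [ne_eq, OfNat.zero_ne_ofNat, not_false_eq_true, Function.update_of_ne]
    rw [h']
    simp
    ring
  have hD1 : ∀ i : Fin 3, DL (ext 2 L) 2 (pq (ext 2 L) 2 i) =
      fun q _ => (m * τ^2 / 16) * q 3 i + (-(m * τ / 4)) * q 2 i := by
    intro i
    funext q w
    rw [hpq2, DL_linear _ _ _ _ le_rfl le_rfl, hpz]
    field_simp
    ring
  have hD2 : ∀ (i : Fin 3) (q : Jet 3) (w : ℝ),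
      DL (ext 2 L) 3 (DL (ext 2 L) 2 (pq (ext 2 L) 2 i)) q w =
        (m * τ^2 / 16) * q 4 i - (m * τ / 2) * q 3 i + m * q 2 i := by
    intro i q w
    rw [hD1, DL_linear _ _ _ _ le_rfl (by norm_num), hpz]
    field_simp
    ring
  refine forall_congr' fun t => forall_congr' fun i => ?_
  have hlift0 : lift c t 0 = c t := by simp [lift]
  simp only [Finset.sum_range_succ, Finset.sum_range_zero, DLpow, Nat.add_zero, Nat.reduceAdd,
    hD2, hpq1, DL_zero, hpq0, hlift0, iteratedDeriv_apply_coord hc]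
  simp only [lift]
  constructor <;> intro h <;> linarith

end HOC
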